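/- arXiv:2512.22691 — 3 statements merged into one kernel-verified Lean document; each statement's English description precedes it below -/
import Mathlib

section
/- Let X ∈ [-A, A] be a discrete random variable with K > 1 mass points, Z standard normal independent of X, and U uniform on [-A, A]. Then the chi-square divergence between the wrapped output laws satisfies χ²(P_{⟨X+Z⟩_A} ‖ P_{⟨U+Z⟩_A}) ≥ (1/2) exp(-4π² K²/A²). -/
open Real MeasureTheory Finset

noncomputable def stdNormalPdf (t : ℝ) : ℝ := (Real.sqrt (2 * π))⁻¹ * Real.exp (-t ^ 2 / 2)

/-- The trigonometric moments of a discrete measure with weights `p` and atoms `y`. -/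
noncomputable def trigMoment {ι : Type*} [Fintype ι] (p y : ι → ℝ) (n : ℤ) : ℂ :=
  ∑ m, (p m : ℂ) * Complex.exp (-(n * y m) * Complex.I)

section TrigMoment

variable {ι : Type*} [Fintype ι] (p y : ι → ℝ)

lemma normSq_trigMoment_eq_sum (n : ℤ) :
    ((‖trigMoment p y n‖ ^ 2 : ℝ) : ℂ) =
      ∑ m, ∑ l, (p m : ℂ) * p l * Complex.exp (-(n * (y m - y l)) * Complex.I) := by
  rw [Complex.ofReal_pow, ← Complex.mul_conj', trigMoment, map_sum, Finset.sum_mul_sum]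
  refine Finset.sum_congr rfl fun m _ => Finset.sum_congr rfl fun l _ => ?_
  rw [map_mul, Complex.conj_ofReal, ← Complex.exp_conj, mul_mul_mul_comm, ← Complex.exp_add]
  congr 2
  simp
  ring

/-- The squared Frobenius norm of a Toeplitz moment matrix is a double sum of Dirichlet kernels. -/
lemma sum_normSq_trigMoment_eq (N : ℕ) :
    ∑ i ∈ range N, ∑ j ∈ range N, ‖trigMoment p y ((i : ℤ) - j)‖ ^ 2 =
      ∑ m, ∑ l, p m * p l *
        ‖∑ i ∈ range N, Complex.exp (-(i * (y m - y l)) * Complex.I)‖ ^ 2 := by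
  apply Complex.ofReal_injective
  rw [Complex.ofReal_sum]
  simp_rw [Complex.ofReal_sum, normSq_trigMoment_eq_sum]
  have h : ∀ m l, (((p m * p l * ‖∑ i ∈ range N,
      Complex.exp (-(i * (y m - y l)) * Complex.I)‖ ^ 2 : ℝ)) : ℂ) =
      ∑ i ∈ range N, ∑ j ∈ range N,
        (p m : ℂ) * p l * Complex.exp (-(((i : ℤ) - j : ℤ) * (y m - y l)) * Complex.I) := by
    intro m l
    rw [Complex.ofReal_mul, Complex.ofReal_mul, Complex.ofReal_pow, ← Complex.mul_conj', map_sum,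
      Finset.sum_mul_sum, Finset.mul_sum]
    refine Finset.sum_congr rfl fun i _ => ?_
    rw [Finset.mul_sum]
    refine Finset.sum_congr rfl fun j _ => ?_
    rw [← Complex.exp_conj, ← Complex.exp_add]
    congr 2
    simp
    ring
  simp_rw [h]
  calc _ = ∑ i ∈ range N, ∑ m, ∑ j ∈ range N, ∑ l,
        (p m : ℂ) * p l * Complex.exp (-(((i : ℤ) - j : ℤ) * (y m - y l)) * Complex.I) :=
        Finset.sum_congr rfl fun i _ => Finset.sum_comm
    _ = ∑ m, ∑ i ∈ range N, ∑ l, ∑ j ∈ range N,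
        (p m : ℂ) * p l * Complex.exp (-(((i : ℤ) - j : ℤ) * (y m - y l)) * Complex.I) := by
        rw [Finset.sum_comm]
        exact Finset.sum_congr rfl fun m _ => Finset.sum_congr rfl fun i _ => Finset.sum_comm
    _ = _ := Finset.sum_congr rfl fun m _ => Finset.sum_comm

variable {p}

lemma sq_le_card_mul_sum_normSq_trigMoment (hp : ∀ m, 0 ≤ p m) (hsum : ∑ m, p m = 1) (N : ℕ) :
    (N : ℝ) ^ 2 ≤ Fintype.card ι *
      ∑ i ∈ range N, ∑ j ∈ range N, ‖trigMoment p y ((i : ℤ) - j)‖ ^ 2 := by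
  have h1 : (1 : ℝ) ≤ Fintype.card ι * ∑ m, p m ^ 2 := by
    have := sq_sum_le_card_mul_sum_sq (s := univ) (f := p)
    rwa [hsum, one_pow, Finset.card_univ] at this
  have h2 : (N : ℝ) ^ 2 * ∑ m, p m ^ 2 ≤
      ∑ i ∈ range N, ∑ j ∈ range N, ‖trigMoment p y ((i : ℤ) - j)‖ ^ 2 := by
    rw [sum_normSq_trigMoment_eq, Finset.mul_sum]
    refine Finset.sum_le_sum fun m _ => ?_
    refine le_trans (le_of_eq ?_) (Finset.single_le_sum (f := fun l => p m * p l *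
      ‖∑ i ∈ range N, Complex.exp (-(i * (y m - y l)) * Complex.I)‖ ^ 2)
      (fun l _ => mul_nonneg (mul_nonneg (hp m) (hp l)) (sq_nonneg _)) (Finset.mem_univ m))
    simp
    ring
  nlinarith [sq_nonneg (N : ℝ), Nat.cast_nonneg (α := ℝ) (Fintype.card ι)]

lemma trigMoment_zero (hsum : ∑ m, p m = 1) : trigMoment p y 0 = 1 := by
  simp only [trigMoment, Int.cast_zero, zero_mul, neg_zero, Complex.exp_zero, mul_one]
  exact_mod_cast hsum

/-- A probability measure with `K` atoms has total squared moment at least one among the nonzero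
frequencies up to `2 * K`. -/
lemma one_le_sum_normSq_trigMoment (hp : ∀ m, 0 ≤ p m) (hsum : ∑ m, p m = 1) :
    1 ≤ ∑ n ∈ (Icc (-(2 * Fintype.card ι : ℤ)) (2 * Fintype.card ι)).erase 0,
      ‖trigMoment p y n‖ ^ 2 := by
  set K := Fintype.card ι with hK
  set S := ∑ n ∈ (Icc (-(2 * K : ℤ)) (2 * K)).erase 0, ‖trigMoment p y n‖ ^ 2
  have hS : ∑ n ∈ Icc (-(2 * K : ℤ)) (2 * K), ‖trigMoment p y n‖ ^ 2 = S + 1 := by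
    rw [← Finset.sum_erase_add _ _ (a := (0 : ℤ)) (by simp), trigMoment_zero y hsum]
    simp [S]
  have hrow : ∀ i ∈ range (2 * K + 1),
      ∑ j ∈ range (2 * K + 1), ‖trigMoment p y ((i : ℤ) - j)‖ ^ 2 ≤ S + 1 := by
    intro i hi
    rw [← hS, ← Finset.sum_image (s := range (2 * K + 1)) (g := fun j : ℕ => (i : ℤ) - j)
      (f := fun n => ‖trigMoment p y n‖ ^ 2) (by intro a _ b _ h; simpa using h)]
    refine Finset.sum_le_sum_of_subset_of_nonneg ?_ fun _ _ _ => sq_nonneg _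
    intro n hn
    simp only [Finset.mem_image, Finset.mem_range, Finset.mem_Icc] at hn hi ⊢
    obtain ⟨j, hj, rfl⟩ := hn
    omega
  have h1 := sq_le_card_mul_sum_normSq_trigMoment y hp hsum (2 * K + 1)
  have h2 := Finset.sum_le_sum hrow
  rw [Finset.sum_const, Finset.card_range, nsmul_eq_mul] at h2
  push_cast at h1 h2
  have hK0 : (0 : ℝ) ≤ K := Nat.cast_nonneg _
  have h3 := h1.trans (mul_le_mul_of_nonneg_left h2 hK0)
  by_contra! hlt
  nlinarith [mul_nonneg hK0 (by linarith : (0 : ℝ) ≤ 2 * K + 1),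
    mul_nonneg (mul_nonneg hK0 (by linarith : (0 : ℝ) ≤ 2 * K + 1)) (sub_nonneg.2 hlt.le)]

end TrigMoment

/-- Parseval's identity for an absolutely convergent trigonometric series. -/
lemma hasSum_normSq_of_summable_norm {c : ℤ → ℂ} (hc : Summable fun n => ‖c n‖) :
    HasSum (fun n => ‖c n‖ ^ 2)
      ((2 * π)⁻¹ * ∫ θ in (-π)..π, ‖∑' n : ℤ, c n * Complex.exp (n * θ * Complex.I)‖ ^ 2) := by
  have : Fact (0 < 2 * π) := ⟨by positivity⟩
  let u : ℤ → C(AddCircle (2 * π), ℂ) := fun n => c n • fourier n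
  have hu : Summable u := Summable.of_norm (by simpa only [u, norm_smul, fourier_norm, mul_one] using hc)
  set G : C(AddCircle (2 * π), ℂ) := ∑' n, u n
  have hG : ∀ t, G t = ∑' n, c n * fourier n t := fun t => by
    simp only [G, ← ContinuousMap.tsum_apply hu, u, ContinuousMap.smul_apply, smul_eq_mul]
  have hcoeff : ∀ k, fourierCoeff G k = c k := by
    intro k
    have h := hasSum_integral_of_summable_integral_norm
      (μ := (AddCircle.haarAddCircle : Measure (AddCircle (2 * π))))
      (F := fun n t => fourier (-k) t • u n t)
      (fun n => ((map_continuous (fourier (-k))).smul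
        (map_continuous (u n))).integrable_of_hasCompactSupport
          (HasCompactSupport.of_compactSpace _))
      (by
        refine hc.congr fun n => ?_
        simp [u, fourier_apply, Circle.norm_coe])
    have h2 : ∫ t, ∑' n, fourier (-k) t • u n t ∂AddCircle.haarAddCircle = fourierCoeff G k := by
      refine integral_congr_ae (Filter.Eventually.of_forall fun t => ?_)
      simp only [hG, smul_eq_mul, u, ContinuousMap.smul_apply, tsum_mul_left]
    rw [h2] at h
    refine h.unique ?_
    have h3 : ∀ n, ∫ t, fourier (-k) t • u n t ∂AddCircle.haarAddCircle =
        if n = k then c k else 0 := by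
      intro n
      change fourierCoeff (c n • ⇑(fourier n)) k = _
      rw [fourierCoeff.const_smul, fourierCoeff_fourier]
      by_cases hnk : n = k
      · simp [hnk]
      · simp [hnk, Ne.symm hnk]
    simp_rw [h3]
    exact hasSum_ite_eq k (c k)
  have hP := hasSum_sq_fourierCoeff (ContinuousMap.toLp 2 AddCircle.haarAddCircle ℂ G)
  simp_rw [fourierCoeff_toLp, hcoeff] at hP
  convert hP using 1
  have h4 : ∫ t, ‖ContinuousMap.toLp (E := ℂ) 2 AddCircle.haarAddCircle ℂ G t‖ ^ 2
      ∂AddCircle.haarAddCircle = ∫ t, ‖G t‖ ^ 2 ∂AddCircle.haarAddCircle := by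
    refine integral_congr_ae ?_
    filter_upwards [ContinuousMap.coeFn_toLp (p := 2) (𝕜 := ℂ) AddCircle.haarAddCircle G]
      with t ht
    rw [ht]
  rw [h4, AddCircle.integral_haarAddCircle, ← AddCircle.intervalIntegral_preimage (2 * π) (-π),
    smul_eq_mul, show -π + 2 * π = π by ring]
  congr 1
  refine intervalIntegral.integral_congr fun θ _ => ?_
  simp only [hG, fourier_coe_apply]
  congr 3
  ext n
  congr 2
  push_cast
  field_simp

lemma summable_exp_neg_mul_sq {a : ℝ} (ha : 0 < a) :
    Summable fun n : ℤ => Real.exp (-a * (n : ℝ) ^ 2) := by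
  have h := ((summable_jacobiTheta₂_term_iff 0 (a / π * Complex.I)).2 (by
    simpa using (by positivity : 0 < a / π))).norm
  refine h.congr fun n => ?_
  rw [norm_jacobiTheta₂_term]
  congr 1
  simp
  field_simp

lemma summable_stdNormalPdf_comp {A : ℝ} (hA : 0 < A) (x θ : ℝ) :
    Summable fun j : ℤ => stdNormalPdf ((A / π) * (θ + 2 * π * j) - x) := by
  have hpos : 0 < (Complex.I * (2 * A ^ 2 / π : ℝ)).im := by
    rw [Complex.I_mul_im, Complex.ofReal_re]
    positivity
  have h := ((summable_jacobiTheta₂_term_iff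
    (Complex.I * (A * (A / π * θ - x) / π : ℝ)) _).2 hpos).norm
  refine (h.mul_left ((Real.sqrt (2 * π))⁻¹ * Real.exp (-(A / π * θ - x) ^ 2 / 2))).congr
    fun n => ?_
  rw [norm_jacobiTheta₂_term, stdNormalPdf, mul_assoc, ← Real.exp_add, Complex.I_mul_im,
    Complex.I_mul_im, Complex.ofReal_re, Complex.ofReal_re]
  congr 2
  field_simp
  ring

/-- The Gaussian density wrapped at period `2 * A`, as a Fourier series. -/
lemma tsum_stdNormalPdf_eq {A : ℝ} (hA : 0 < A) (x θ : ℝ) :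
    2 * A * ∑' j : ℤ, (stdNormalPdf ((A / π) * (θ + 2 * π * j) - x) : ℂ) =
      ∑' n : ℤ, (Real.exp (-(π ^ 2 / (2 * A ^ 2)) * (n : ℝ) ^ 2) : ℂ) *
        Complex.exp (-(n * ((π * x / A : ℝ) : ℂ)) * Complex.I) *
          Complex.exp (n * θ * Complex.I) := by
  have hπ : (π : ℂ) ≠ 0 := Complex.ofReal_ne_zero.2 pi_ne_zero
  have hA' : (A : ℂ) ≠ 0 := Complex.ofReal_ne_zero.2 hA.ne'
  have ha : 0 < π / (2 * A ^ 2) := by positivity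
  have h := Complex.tsum_exp_neg_quadratic (a := ((π / (2 * A ^ 2) : ℝ) : ℂ))
    (by rwa [Complex.ofReal_re]) (Complex.I * (θ - π * x / A) / (2 * π))
  have hl : ∀ n : ℤ, (Real.exp (-(π ^ 2 / (2 * A ^ 2)) * (n : ℝ) ^ 2) : ℂ) *
        Complex.exp (-(n * ((π * x / A : ℝ) : ℂ)) * Complex.I) *
          Complex.exp (n * θ * Complex.I) =
      Complex.exp (-π * ((π / (2 * A ^ 2) : ℝ) : ℂ) * n ^ 2 +
        2 * π * (Complex.I * (θ - π * x / A) / (2 * π)) * n) := by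
    intro n
    rw [Complex.ofReal_exp, ← Complex.exp_add, ← Complex.exp_add]
    congr 1
    push_cast
    field_simp
    ring
  simp_rw [hl]
  rw [h, ← (Equiv.neg ℤ).tsum_eq (fun n : ℤ => Complex.exp _), ← tsum_mul_left, ← tsum_mul_left]
  refine tsum_congr fun j => ?_
  have hroot : ((π / (2 * A ^ 2) : ℝ) : ℂ) ^ (1 / 2 : ℂ) =
      ((Real.sqrt (2 * π) / (2 * A) : ℝ) : ℂ) := by
    rw [show (1 / 2 : ℂ) = ((1 / 2 : ℝ) : ℂ) by push_cast; rfl, ← Complex.ofReal_cpow ha.le,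
      ← Real.sqrt_eq_rpow]
    congr 1
    rw [Real.sqrt_eq_iff_mul_self_eq ha.le (by positivity), div_mul_div_comm,
      Real.mul_self_sqrt (by positivity)]
    field_simp
  have he : Complex.exp (-π / ((π / (2 * A ^ 2) : ℝ) : ℂ) * (((Equiv.neg ℤ j : ℤ) : ℂ) +
      Complex.I * (Complex.I * (θ - π * x / A) / (2 * π))) ^ 2) =
      (Real.exp (-((A / π) * (θ + 2 * π * j) - x) ^ 2 / 2) : ℂ) := by
    rw [Complex.ofReal_exp]
    congr 1
    rw [← mul_div_assoc, ← mul_assoc, Complex.I_mul_I]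
    push_cast [Equiv.neg_apply]
    field_simp
    ring
  rw [he, hroot, stdNormalPdf]
  push_cast
  field_simp

theorem stmt_9 (A : ℝ) (hA : 0 < A) (K : ℕ) (hK : 1 < K)
    (x : Fin K → ℝ) (hx : ∀ m, x m ∈ Set.Icc (-A) A) (hinj : Function.Injective x)
    (p : Fin K → ℝ) (hp : ∀ m, 0 < p m) (hsum : ∑ m, p m = 1)
    (f : ℝ → ℝ)
    (hf : ∀ θ, f θ =
      (A / π) * ∑' j : ℤ, ∑ m, p m * stdNormalPdf ((A / π) * (θ + 2 * π * j) - x m)) :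
    (1 / 2) * Real.exp (-4 * π ^ 2 * (K : ℝ) ^ 2 / A ^ 2) ≤
      ∫ θ in Set.Ioo (-π) π, (f θ - 1 / (2 * π)) ^ 2 / (1 / (2 * π)) := by
  have hπ : (π : ℂ) ≠ 0 := Complex.ofReal_ne_zero.2 pi_ne_zero
  set y : Fin K → ℝ := fun m => π * x m / A
  set g : ℤ → ℝ := fun n => Real.exp (-(π ^ 2 / (2 * A ^ 2)) * (n : ℝ) ^ 2)
  have hg : Summable g := summable_exp_neg_mul_sq (by positivity)
  let c : ℤ → ℂ := fun n => g n * trigMoment p y n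
  let d : ℤ → ℂ := fun n => if n = 0 then 0 else c n
  have htm : ∀ m (θ : ℝ), Summable fun n : ℤ => (g n : ℂ) *
      Complex.exp (-(n * (y m : ℂ)) * Complex.I) * Complex.exp (n * θ * Complex.I) := by
    refine fun m θ => Summable.of_norm (hg.congr fun n => ?_)
    have h1 := Complex.norm_exp_ofReal_mul_I (-(n * y m))
    have h2 := Complex.norm_exp_ofReal_mul_I (n * θ)
    push_cast at h1 h2
    rw [norm_mul, norm_mul, h1, h2, mul_one, mul_one, Complex.norm_of_nonneg (Real.exp_pos _).le]
  have hcm : ∀ (θ : ℝ) n, c n * Complex.exp (n * θ * Complex.I) = ∑ m, (p m : ℂ) * ((g n : ℂ) *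
      Complex.exp (-(n * (y m : ℂ)) * Complex.I) * Complex.exp (n * θ * Complex.I)) := by
    intro θ n
    simp only [c, trigMoment, Finset.mul_sum, Finset.sum_mul]
    exact Finset.sum_congr rfl fun m _ => by ring
  have hcs : ∀ θ : ℝ, Summable fun n : ℤ => c n * Complex.exp (n * θ * Complex.I) := by
    intro θ
    simp_rw [hcm]
    exact summable_sum fun m _ => (htm m θ).mul_left _
  have hfc : ∀ θ : ℝ, ((2 * π * f θ : ℝ) : ℂ) =
      ∑' n : ℤ, c n * Complex.exp (n * θ * Complex.I) := by
    intro θ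
    simp_rw [hcm]
    rw [Summable.tsum_finsetSum fun m _ => (htm m θ).mul_left _, hf,
      Summable.tsum_finsetSum fun m _ => (summable_stdNormalPdf_comp hA (x m) θ).mul_left _]
    simp_rw [tsum_mul_left, g, y, ← tsum_stdNormalPdf_eq hA]
    push_cast
    rw [← mul_assoc, Finset.mul_sum]
    refine Finset.sum_congr rfl fun m _ => ?_
    field_simp
  have hc0 : c 0 = 1 := by
    simp [c, g, trigMoment_zero y hsum]
  have hds : Summable fun n => ‖d n‖ := by
    have h := (hcs 0).norm
    refine Summable.of_nonneg_of_le (fun _ => norm_nonneg _) (fun n => ?_) h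
    by_cases hn : n = 0
    · simp [d, hn]
    · simp [d, hn]
  have hfd : ∀ θ : ℝ, ((2 * π * f θ - 1 : ℝ) : ℂ) =
      ∑' n : ℤ, d n * Complex.exp (n * θ * Complex.I) := by
    intro θ
    rw [Complex.ofReal_sub, hfc, (hcs θ).tsum_eq_add_tsum_ite 0]
    simp only [hc0, Int.cast_zero, zero_mul, Complex.exp_zero, mul_one, Complex.ofReal_one,
      add_sub_cancel_left, d, ite_mul]
  have hP := hasSum_normSq_of_summable_norm hds
  have hint : (2 * π)⁻¹ * ∫ θ in (-π)..π, ‖∑' n : ℤ, d n * Complex.exp (n * θ * Complex.I)‖ ^ 2 =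
      ∫ θ in Set.Ioo (-π) π, (f θ - 1 / (2 * π)) ^ 2 / (1 / (2 * π)) := by
    rw [intervalIntegral.integral_of_le (by linarith [pi_pos]), integral_Ioc_eq_integral_Ioo,
      ← integral_const_mul]
    congr 1
    ext θ
    rw [← hfd, Complex.norm_real, Real.norm_eq_abs, sq_abs]
    field_simp
  rw [hint] at hP
  have hM := one_le_sum_normSq_trigMoment y (fun m => (hp m).le) hsum
  rw [Fintype.card_fin] at hM
  set S := (Icc (-(2 * K : ℤ)) (2 * K)).erase 0
  have hE : 0 < Real.exp (-4 * π ^ 2 * (K : ℝ) ^ 2 / A ^ 2) := Real.exp_pos _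
  calc (1 / 2) * Real.exp (-4 * π ^ 2 * (K : ℝ) ^ 2 / A ^ 2)
      ≤ Real.exp (-4 * π ^ 2 * (K : ℝ) ^ 2 / A ^ 2) * ∑ n ∈ S, ‖trigMoment p y n‖ ^ 2 := by
        nlinarith
    _ ≤ ∑ n ∈ S, ‖d n‖ ^ 2 := by
        rw [Finset.mul_sum]
        refine Finset.sum_le_sum fun n hn => ?_
        simp only [S, Finset.mem_erase, Finset.mem_Icc] at hn
        obtain ⟨hn0, hn1, hn2⟩ := hn
        simp only [d, hn0, if_false, c, norm_mul, mul_pow,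
          Complex.norm_of_nonneg (Real.exp_pos _).le, g]
        refine mul_le_mul_of_nonneg_right ?_ (sq_nonneg _)
        rw [← Real.exp_nat_mul]
        apply Real.exp_le_exp.2
        have hn3 : (n : ℝ) ^ 2 ≤ (2 * K) ^ 2 :=
          sq_le_sq' (by exact_mod_cast hn1) (by exact_mod_cast hn2)
        rw [show ((2 : ℕ) : ℝ) * (-(π ^ 2 / (2 * A ^ 2)) * (n : ℝ) ^ 2) =
          -(π ^ 2 * (n : ℝ) ^ 2) / A ^ 2 by push_cast; field_simp]
        gcongr
        nlinarith [mul_le_mul_of_nonneg_left hn3 (sq_nonneg π)]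
    _ ≤ _ := sum_le_hasSum S (fun _ _ => sq_nonneg _) hP
end

section
/- Let X* be the capacity-achieving input of the amplitude-constrained AWGN channel with |X| ≤ A and Z ~ N(0,1), and let U ~ Uniform[-A, A]. Then D(P_{U+Z} ‖ P_{X*+Z}) ≤ √(πe/2)/A. -/
open Real MeasureTheory

/-- Output density of the AWGN channel under input distribution `Q`. -/
noncomputable def outDen (Q : Measure ℝ) (y : ℝ) : ℝ := ∫ x, stdNormalPdf (y - x) ∂Q

/-- Mutual information `I(X; X+Z)` for input distribution `Q` on the AWGN channel. -/
noncomputable def awgnMI (Q : Measure ℝ) : ℝ :=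
  ∫ x, (∫ y : ℝ, stdNormalPdf (y - x) * Real.log (stdNormalPdf (y - x) / outDen Q y)) ∂Q

/-! ### The Gaussian density and output densities -/

lemma stdNormalPdf_pos (t : ℝ) : 0 < stdNormalPdf t := by
  unfold stdNormalPdf; positivity

lemma continuous_stdNormalPdf : Continuous stdNormalPdf := by
  unfold stdNormalPdf; fun_prop

lemma stdNormalPdf_eq_gaussianPDFReal :
    stdNormalPdf = ProbabilityTheory.gaussianPDFReal 0 1 := by
  ext t; simp [stdNormalPdf, ProbabilityTheory.gaussianPDFReal]

lemma integrable_stdNormalPdf : Integrable stdNormalPdf := by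
  rw [stdNormalPdf_eq_gaussianPDFReal]
  exact ProbabilityTheory.integrable_gaussianPDFReal 0 1

lemma integral_stdNormalPdf : ∫ t, stdNormalPdf t = 1 := by
  rw [stdNormalPdf_eq_gaussianPDFReal]
  exact ProbabilityTheory.integral_gaussianPDFReal_eq_one 0 one_ne_zero

lemma stdNormalPdf_neg (t : ℝ) : stdNormalPdf (-t) = stdNormalPdf t := by
  simp [stdNormalPdf]

lemma exp_neg_one_le_inv_sqrt_two_pi : exp (-1) ≤ (√(2 * π))⁻¹ := by
  rw [exp_neg]
  refine inv_anti₀ (by positivity) (sqrt_le_iff.2 ⟨by positivity, ?_⟩)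
  nlinarith [exp_one_gt_d9, pi_lt_d2]

lemma inv_sqrt_two_pi_le_one : (√(2 * π))⁻¹ ≤ 1 :=
  inv_le_one_of_one_le₀ (one_le_sqrt.2 (by nlinarith [pi_gt_three]))

lemma stdNormalPdf_le_one (t : ℝ) : stdNormalPdf t ≤ 1 := by
  unfold stdNormalPdf
  exact mul_le_one₀ inv_sqrt_two_pi_le_one (exp_nonneg _)
    (exp_le_one_iff.2 (by nlinarith [sq_nonneg t]))

section Bounds

variable {A x : ℝ}

lemma stdNormalPdf_sub_le (hx : x ∈ Set.Icc (-A) A) (y : ℝ) :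
    stdNormalPdf (y - x) ≤ exp (5 / 2 * A ^ 2 + 1 - 3 / 8 * y ^ 2) := by
  have hxA : x ^ 2 ≤ A ^ 2 := sq_le_sq' hx.1 hx.2
  unfold stdNormalPdf
  refine (mul_le_of_le_one_left (exp_nonneg _) inv_sqrt_two_pi_le_one).trans (exp_le_exp.2 ?_)
  nlinarith [sq_nonneg (y / 2 - 2 * x), sq_nonneg A]

lemma le_stdNormalPdf_sub (hx : x ∈ Set.Icc (-A) A) (y : ℝ) :
    exp (-(5 / 2 * A ^ 2 + 1) - 5 / 8 * y ^ 2) ≤ stdNormalPdf (y - x) := by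
  have hxA : x ^ 2 ≤ A ^ 2 := sq_le_sq' hx.1 hx.2
  unfold stdNormalPdf
  calc exp (-(5 / 2 * A ^ 2 + 1) - 5 / 8 * y ^ 2)
      ≤ exp (-1 + -(y - x) ^ 2 / 2) := exp_le_exp.2 (by nlinarith [sq_nonneg (y / 2 + 2 * x)])
    _ = exp (-1) * exp (-(y - x) ^ 2 / 2) := exp_add _ _
    _ ≤ _ := by gcongr; exact exp_neg_one_le_inv_sqrt_two_pi

end Bounds

lemma integrable_stdNormalPdf_sub (Q : Measure ℝ) [IsFiniteMeasure Q] (y : ℝ) :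
    Integrable (fun x => stdNormalPdf (y - x)) Q := by
  refine Integrable.of_bound (C := 1)
    (continuous_stdNormalPdf.comp (by fun_prop)).aestronglyMeasurable (.of_forall fun x => ?_)
  rw [norm_of_nonneg (stdNormalPdf_pos _).le]
  exact stdNormalPdf_le_one _

lemma measurable_outDen (Q : Measure ℝ) [SFinite Q] : Measurable (outDen Q) := by
  have : StronglyMeasurable (fun p : ℝ × ℝ => stdNormalPdf (p.1 - p.2)) :=
    (continuous_stdNormalPdf.comp (by fun_prop)).stronglyMeasurable
  exact this.integral_prod_right'.measurable

section OutDen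

variable {A : ℝ} {Q : Measure ℝ} [IsProbabilityMeasure Q]

lemma outDen_le (hQ : ∀ᵐ x ∂Q, x ∈ Set.Icc (-A) A) (y : ℝ) :
    outDen Q y ≤ exp (5 / 2 * A ^ 2 + 1 - 3 / 8 * y ^ 2) := by
  have := integral_mono_ae (integrable_stdNormalPdf_sub Q y) (integrable_const _)
    (hQ.mono fun x hx => stdNormalPdf_sub_le hx y)
  simpa [outDen] using this

lemma le_outDen (hQ : ∀ᵐ x ∂Q, x ∈ Set.Icc (-A) A) (y : ℝ) :
    exp (-(5 / 2 * A ^ 2 + 1) - 5 / 8 * y ^ 2) ≤ outDen Q y := by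
  have := integral_mono_ae (integrable_const _) (integrable_stdNormalPdf_sub Q y)
    (hQ.mono fun x hx => le_stdNormalPdf_sub hx y)
  simpa [outDen] using this

lemma outDen_pos (hQ : ∀ᵐ x ∂Q, x ∈ Set.Icc (-A) A) (y : ℝ) : 0 < outDen Q y :=
  (exp_pos _).trans_le (le_outDen hQ y)

end OutDen

/-! ### Functions of quadratic growth -/

/-- A measurable function bounded by a multiple of `1 + y ^ 2`. -/
def QuadGrowth (g : ℝ → ℝ) : Prop := Measurable g ∧ ∃ C, ∀ y, |g y| ≤ C * (1 + y ^ 2)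

lemma quadGrowth_const (c : ℝ) : QuadGrowth fun _ => c :=
  ⟨measurable_const, |c|, fun y => le_mul_of_one_le_right (abs_nonneg c) (by nlinarith)⟩

lemma QuadGrowth.add {g₁ g₂ : ℝ → ℝ} (h₁ : QuadGrowth g₁) (h₂ : QuadGrowth g₂) :
    QuadGrowth fun y => g₁ y + g₂ y := by
  obtain ⟨m₁, C₁, hC₁⟩ := h₁
  obtain ⟨m₂, C₂, hC₂⟩ := h₂
  exact ⟨m₁.add m₂, C₁ + C₂, fun y => (abs_add_le _ _).trans (by linarith [hC₁ y, hC₂ y])⟩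

lemma QuadGrowth.comp_affine {g : ℝ → ℝ} (hg : QuadGrowth g) (a b : ℝ) :
    QuadGrowth fun y => g (a * y + b) := by
  obtain ⟨m, C, hC⟩ := hg
  have hC0 : 0 ≤ C := by simpa using (abs_nonneg _).trans (hC 0)
  refine ⟨m.comp (by fun_prop), C * (1 + 2 * a ^ 2 + 2 * b ^ 2), fun y => (hC _).trans ?_⟩
  rw [mul_assoc]
  refine mul_le_mul_of_nonneg_left ?_ hC0
  nlinarith [sq_nonneg (a * y - b), sq_nonneg (b * y), sq_nonneg a, sq_nonneg y]

lemma integrable_of_quadratic_mul_gaussian_bound {F : ℝ → ℝ} (hF : Measurable F) {C b : ℝ}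
    (hb : 0 < b) (hC : ∀ y, |F y| ≤ C * (1 + y ^ 2) * exp (-b * y ^ 2)) : Integrable F := by
  have h0 : Integrable fun y : ℝ => exp (-b * y ^ 2) := integrable_exp_neg_mul_sq hb
  have h2 : Integrable fun y : ℝ => y ^ 2 * exp (-b * y ^ 2) := by
    simpa using integrable_rpow_mul_exp_neg_mul_sq hb (s := 2) (by norm_num)
  refine ((h0.add h2).const_mul C).mono' hF.aestronglyMeasurable (.of_forall fun y => ?_)
  rw [norm_eq_abs]
  refine (hC y).trans (le_of_eq ?_)
  simp only [Pi.add_apply]; ring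

section OutDenIntegrals

variable {A : ℝ} {Q : Measure ℝ} [IsProbabilityMeasure Q]

lemma quadGrowth_log_outDen (hQ : ∀ᵐ x ∂Q, x ∈ Set.Icc (-A) A) :
    QuadGrowth fun y => log (outDen Q y) := by
  refine ⟨(measurable_outDen Q).log, 5 / 2 * A ^ 2 + 2, fun y => ?_⟩
  have hl := (le_log_iff_exp_le (outDen_pos hQ y)).2 (le_outDen hQ y)
  have hu := (log_le_iff_le_exp (outDen_pos hQ y)).2 (outDen_le hQ y)
  rw [abs_le]
  constructor <;> nlinarith [mul_nonneg (sq_nonneg A) (sq_nonneg y), sq_nonneg y]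

lemma integrable_outDen_mul (hQ : ∀ᵐ x ∂Q, x ∈ Set.Icc (-A) A) {g : ℝ → ℝ} (hg : QuadGrowth g) :
    Integrable fun y => outDen Q y * g y := by
  obtain ⟨m, C, hC⟩ := hg
  refine integrable_of_quadratic_mul_gaussian_bound (C := exp (5 / 2 * A ^ 2 + 1) * C)
    (b := 3 / 8) ((measurable_outDen Q).mul m) (by norm_num) fun y => ?_
  rw [abs_mul, abs_of_pos (outDen_pos hQ y)]
  calc outDen Q y * |g y|
      ≤ exp (5 / 2 * A ^ 2 + 1 - 3 / 8 * y ^ 2) * (C * (1 + y ^ 2)) :=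
        mul_le_mul (outDen_le hQ y) (hC y) (abs_nonneg _) (exp_nonneg _)
    _ = _ := by rw [sub_eq_add_neg, exp_add, neg_mul]; ring

lemma integrable_outDen (hQ : ∀ᵐ x ∂Q, x ∈ Set.Icc (-A) A) : Integrable (outDen Q) := by
  simpa using integrable_outDen_mul hQ (quadGrowth_const 1)

lemma outDen_dirac (x y : ℝ) : outDen (Measure.dirac x) y = stdNormalPdf (y - x) := by
  simp [outDen]

lemma integrable_stdNormalPdf_sub_mul {g : ℝ → ℝ} (hg : QuadGrowth g) (x : ℝ) :
    Integrable fun y => stdNormalPdf (y - x) * g y := by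
  have hx : ∀ᵐ z ∂Measure.dirac x, z ∈ Set.Icc (-|x|) |x| := by
    rw [ae_dirac_eq]; exact ⟨neg_abs_le x, le_abs_self x⟩
  simpa only [outDen_dirac] using integrable_outDen_mul hx hg

lemma integrable_prod_stdNormalPdf_sub_mul (hQ : ∀ᵐ x ∂Q, x ∈ Set.Icc (-A) A) {g : ℝ → ℝ}
    (hg : QuadGrowth g) :
    Integrable (fun p : ℝ × ℝ => stdNormalPdf (p.2 - p.1) * g p.2) (Q.prod volume) := by
  have hdom : Integrable fun y => exp (5 / 2 * A ^ 2 + 1 - 3 / 8 * y ^ 2) * |g y| := by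
    obtain ⟨m, C, hC⟩ := hg
    refine integrable_of_quadratic_mul_gaussian_bound (C := exp (5 / 2 * A ^ 2 + 1) * C)
      (b := 3 / 8) (by fun_prop) (by norm_num) fun y => ?_
    rw [abs_mul, abs_abs, abs_of_pos (exp_pos _)]
    calc exp (5 / 2 * A ^ 2 + 1 - 3 / 8 * y ^ 2) * |g y|
        ≤ exp (5 / 2 * A ^ 2 + 1 - 3 / 8 * y ^ 2) * (C * (1 + y ^ 2)) := by gcongr; exact hC y
      _ = _ := by rw [sub_eq_add_neg, exp_add, neg_mul]; ring
  have hmeas : Measurable fun p : ℝ × ℝ => stdNormalPdf (p.2 - p.1) * g p.2 :=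
    (continuous_stdNormalPdf.measurable.comp (by fun_prop)).mul (hg.1.comp measurable_snd)
  refine (hdom.comp_snd Q).mono' hmeas.aestronglyMeasurable ?_
  filter_upwards [Measure.quasiMeasurePreserving_fst.ae hQ] with p hp
  rw [norm_mul, norm_of_nonneg (stdNormalPdf_pos _).le, norm_eq_abs]
  gcongr
  exact stdNormalPdf_sub_le hp _

lemma integral_outDen_mul (hQ : ∀ᵐ x ∂Q, x ∈ Set.Icc (-A) A) {g : ℝ → ℝ} (hg : QuadGrowth g) :
    ∫ y, outDen Q y * g y = ∫ x, (∫ y, stdNormalPdf (y - x) * g y) ∂Q := by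
  rw [integral_integral_swap (integrable_prod_stdNormalPdf_sub_mul hQ hg)]
  simp only [outDen, integral_mul_const]

lemma integral_outDen (hQ : ∀ᵐ x ∂Q, x ∈ Set.Icc (-A) A) : ∫ y, outDen Q y = 1 := by
  have := integral_outDen_mul hQ (quadGrowth_const 1)
  simpa [integral_sub_right_eq_self stdNormalPdf, integral_stdNormalPdf] using this

lemma integral_outDen_mul_nonpos (hQ : ∀ᵐ x ∂Q, x ∈ Set.Icc (-A) A) {g : ℝ → ℝ}
    (hg : QuadGrowth g) (h : ∀ x ∈ Set.Icc (-A) A, ∫ y, stdNormalPdf (y - x) * g y ≤ 0) :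
    ∫ y, outDen Q y * g y ≤ 0 := by
  rw [integral_outDen_mul hQ hg]
  exact integral_nonpos_of_ae (hQ.mono h)

lemma quadGrowth_log_stdNormalPdf : QuadGrowth fun t => log (stdNormalPdf t) := by
  have h0 : ∀ᵐ z ∂Measure.dirac (0 : ℝ), z ∈ Set.Icc (-0 : ℝ) 0 := by
    rw [ae_dirac_eq]; simp
  simpa [outDen_dirac] using quadGrowth_log_outDen h0

/-- Mutual information is the output entropy plus a constant (minus the noise entropy). -/
lemma awgnMI_eq (hQ : ∀ᵐ x ∂Q, x ∈ Set.Icc (-A) A) :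
    awgnMI Q = (∫ t, stdNormalPdf t * log (stdNormalPdf t)) -
      ∫ y, outDen Q y * log (outDen Q y) := by
  have hlog := quadGrowth_log_outDen hQ
  have hφ : ∀ x, QuadGrowth fun y => log (stdNormalPdf (y - x)) := fun x => by
    simpa [sub_eq_add_neg] using quadGrowth_log_stdNormalPdf.comp_affine 1 (-x)
  have hinner : ∀ x, ∫ y, stdNormalPdf (y - x) * log (stdNormalPdf (y - x) / outDen Q y) =
      (∫ t, stdNormalPdf t * log (stdNormalPdf t)) -
        ∫ y, stdNormalPdf (y - x) * log (outDen Q y) := fun x => by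
    rw [← integral_sub_right_eq_self (fun t => stdNormalPdf t * log (stdNormalPdf t)) x,
      ← integral_sub (integrable_stdNormalPdf_sub_mul (hφ x) x)
        (integrable_stdNormalPdf_sub_mul hlog x)]
    refine integral_congr_ae (.of_forall fun y => ?_)
    simp only
    rw [log_div (stdNormalPdf_pos _).ne' (outDen_pos hQ y).ne', mul_sub]
  rw [integral_outDen_mul hQ hlog, awgnMI]
  simp only [hinner]
  rw [integral_sub (integrable_const _)
    (integrable_prod_stdNormalPdf_sub_mul hQ hlog).integral_prod_left]
  simp

end OutDenIntegrals

/-! ### The saddle-point inequality -/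

/-- The mixture `(1 - ε) P + ε Q`. -/
noncomputable def mixture (ε : ℝ) (P Q : Measure ℝ) : Measure ℝ :=
  ENNReal.ofReal (1 - ε) • P + ENNReal.ofReal ε • Q

lemma ae_mixture {ε : ℝ} {P Q : Measure ℝ} {p : ℝ → Prop} (hP : ∀ᵐ x ∂P, p x)
    (hQ : ∀ᵐ x ∂Q, p x) :
    ∀ᵐ x ∂mixture ε P Q, p x :=
  ae_add_measure_iff.2 ⟨Measure.ae_smul_measure hP _, Measure.ae_smul_measure hQ _⟩

section Mixture

variable {A ε : ℝ} {P Q : Measure ℝ} [IsProbabilityMeasure P] [IsProbabilityMeasure Q]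

lemma isProbabilityMeasure_mixture (h0 : 0 ≤ ε) (h1 : ε ≤ 1) :
    IsProbabilityMeasure (mixture ε P Q) := by
  refine ⟨?_⟩
  simp only [mixture, Measure.add_apply, Measure.smul_apply, measure_univ, smul_eq_mul, mul_one]
  rw [← ENNReal.ofReal_add (by linarith) h0]
  simp

lemma outDen_mixture (h0 : 0 ≤ ε) (h1 : ε ≤ 1) (y : ℝ) :
    outDen (mixture ε P Q) y = outDen P y + ε * (outDen Q y - outDen P y) := by
  rw [outDen, mixture, integral_add_measure
    ((integrable_stdNormalPdf_sub P y).smul_measure ENNReal.ofReal_ne_top)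
    ((integrable_stdNormalPdf_sub Q y).smul_measure ENNReal.ofReal_ne_top),
    integral_smul_measure, integral_smul_measure, ENNReal.toReal_ofReal (by linarith),
    ENNReal.toReal_ofReal h0]
  simp only [smul_eq_mul, outDen]
  ring

lemma integrable_sq_sub_div_outDen (hP : ∀ᵐ x ∂P, x ∈ Set.Icc (-A) A)
    (hQ : ∀ᵐ x ∂Q, x ∈ Set.Icc (-A) A) :
    Integrable fun y => (outDen Q y - outDen P y) ^ 2 / outDen P y := by
  have mP := measurable_outDen P
  have mQ := measurable_outDen Q
  set K := 5 / 2 * A ^ 2 + 1 with hK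
  refine integrable_of_quadratic_mul_gaussian_bound (C := exp (3 * K)) (b := 1 / 8)
    (by fun_prop) (by norm_num) fun y => ?_
  have hp := outDen_pos hP y
  have hq := outDen_pos hQ y
  have hup := outDen_le hP y
  have huq := outDen_le hQ y
  have hlp := le_outDen hP y
  rw [← hK] at hup huq hlp
  rw [abs_of_nonneg (by positivity), div_le_iff₀ hp]
  calc (outDen Q y - outDen P y) ^ 2 ≤ exp (K - 3 / 8 * y ^ 2) ^ 2 :=
        sq_le_sq' (by linarith) (by linarith)
    _ = exp (3 * K) * 1 * exp (-(1 / 8) * y ^ 2) * exp (-K - 5 / 8 * y ^ 2) := by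
        rw [mul_one, ← exp_add, ← exp_add, ← exp_nat_mul]; congr 1; push_cast; ring
    _ ≤ exp (3 * K) * (1 + y ^ 2) * exp (-(1 / 8) * y ^ 2) * outDen P y := by
        gcongr
        nlinarith

/-- The output density of an optimal input satisfies the saddle-point inequality. -/
lemma integral_outDen_mul_log_le_of_forall_awgnMI_le (hP : ∀ᵐ x ∂P, x ∈ Set.Icc (-A) A)
    (hopt : ∀ ν : Measure ℝ, IsProbabilityMeasure ν → (∀ᵐ x ∂ν, x ∈ Set.Icc (-A) A) →
      awgnMI ν ≤ awgnMI P) (hQ : ∀ᵐ x ∂Q, x ∈ Set.Icc (-A) A) :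
    ∫ y, outDen P y * log (outDen P y) ≤ ∫ y, outDen Q y * log (outDen P y) := by
  have hlog := quadGrowth_log_outDen hP
  have iPP := integrable_outDen_mul hP hlog
  have iQP := integrable_outDen_mul hQ hlog
  have iP := integrable_outDen hP
  have iQ := integrable_outDen hQ
  have iχ := integrable_sq_sub_div_outDen hP hQ
  set χ := ∫ y, (outDen Q y - outDen P y) ^ 2 / outDen P y
  have key : ∀ ε : ℝ, 0 < ε → ε ≤ 1 →
      0 ≤ (∫ y, outDen Q y * log (outDen P y)) - (∫ y, outDen P y * log (outDen P y)) + ε * χ := by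
    intro ε h0 h1
    have : IsProbabilityMeasure (mixture ε P Q) := isProbabilityMeasure_mixture h0.le h1
    have hM : ∀ᵐ x ∂mixture ε P Q, x ∈ Set.Icc (-A) A := ae_mixture hP hQ
    have hent := hopt _ this hM
    rw [awgnMI_eq hM, awgnMI_eq hP, sub_le_sub_iff_left] at hent
    have hpt : ∀ y, outDen (mixture ε P Q) y * log (outDen (mixture ε P Q) y) ≤
        outDen P y * log (outDen P y) +
          (ε * (outDen Q y * log (outDen P y) - outDen P y * log (outDen P y)) +
          (ε * (outDen Q y - outDen P y) +
          ε ^ 2 * ((outDen Q y - outDen P y) ^ 2 / outDen P y))) := by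
      intro y
      have hp := outDen_pos hP y
      have hm := outDen_pos hM y
      have hl := log_le_sub_one_of_pos (div_pos hm hp)
      rw [log_div hm.ne' hp.ne'] at hl
      calc outDen (mixture ε P Q) y * log (outDen (mixture ε P Q) y)
          ≤ outDen (mixture ε P Q) y *
            (log (outDen P y) + (outDen (mixture ε P Q) y / outDen P y - 1)) := by
              gcongr; linarith
        _ = _ := by
              rw [outDen_mixture h0.le h1]
              field_simp
              ring
    have i₁ : Integrable fun y =>
        ε * (outDen Q y * log (outDen P y) - outDen P y * log (outDen P y)) :=
      (iQP.sub iPP).const_mul ε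
    have i₂ : Integrable fun y => ε * (outDen Q y - outDen P y) := (iQ.sub iP).const_mul ε
    have i₃ : Integrable fun y => ε ^ 2 * ((outDen Q y - outDen P y) ^ 2 / outDen P y) :=
      iχ.const_mul (ε ^ 2)
    have i₂₃ : Integrable fun y => ε * (outDen Q y - outDen P y) +
        ε ^ 2 * ((outDen Q y - outDen P y) ^ 2 / outDen P y) := i₂.add i₃
    have i₁₂₃ : Integrable fun y =>
        ε * (outDen Q y * log (outDen P y) - outDen P y * log (outDen P y)) +
          (ε * (outDen Q y - outDen P y) +
          ε ^ 2 * ((outDen Q y - outDen P y) ^ 2 / outDen P y)) := i₁.add i₂₃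
    have hfin := hent.trans (integral_mono (integrable_outDen_mul hM (quadGrowth_log_outDen hM))
      (iPP.add i₁₂₃) hpt)
    simp only [Pi.add_apply] at hfin
    rw [integral_add iPP i₁₂₃, integral_add i₁ i₂₃, integral_add i₂ i₃, integral_const_mul,
      integral_const_mul, integral_const_mul, integral_sub iQP iPP, integral_sub iQ iP,
      integral_outDen hP, integral_outDen hQ] at hfin
    refine nonneg_of_mul_nonneg_right (a := ε) ?_ h0
    linarith
  have hlim : Filter.Tendsto (fun ε : ℝ => (∫ y, outDen Q y * log (outDen P y)) -
      (∫ y, outDen P y * log (outDen P y)) + ε * χ) (nhdsWithin 0 (Set.Ioi 0))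
      (nhds ((∫ y, outDen Q y * log (outDen P y)) -
      (∫ y, outDen P y * log (outDen P y)) + 0 * χ)) :=
    (Continuous.tendsto (by fun_prop) 0).mono_left nhdsWithin_le_nhds
  have := ge_of_tendsto hlim (by
    filter_upwards [Ioc_mem_nhdsGT one_pos] with ε hε using key ε hε.1 hε.2)
  linarith

end Mixture

/-! ### McKellips' bound on the output entropy -/

/-- The excess `(t ^ 2 - 1) / 2` for `0 < t`, extended by zero. -/
noncomputable def excess : ℝ → ℝ := (Set.Ioi 0).indicator fun t => (t ^ 2 - 1) / 2

lemma excess_of_pos {t : ℝ} (ht : 0 < t) : excess t = (t ^ 2 - 1) / 2 :=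
  Set.indicator_of_mem (Set.mem_Ioi.2 ht) _

lemma excess_of_nonpos {t : ℝ} (ht : t ≤ 0) : excess t = 0 :=
  Set.indicator_of_notMem (by simpa using ht) _

lemma quadGrowth_excess : QuadGrowth excess := by
  refine ⟨Measurable.indicator (by fun_prop) measurableSet_Ioi, 1, fun t => ?_⟩
  rcases lt_or_ge 0 t with ht | ht
  · rw [excess_of_pos ht, abs_le]
    constructor <;> nlinarith [sq_nonneg t]
  · rw [excess_of_nonpos ht, abs_zero]
    positivity

lemma hasDerivAt_mul_stdNormalPdf (t : ℝ) :
    HasDerivAt (fun t => -(t / 2) * stdNormalPdf t) (stdNormalPdf t * ((t ^ 2 - 1) / 2)) t := by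
  have h1 : HasDerivAt (fun t : ℝ => -t ^ 2 / 2) (-t) t := by
    refine ((hasDerivAt_pow 2 t).neg.div_const 2).congr_deriv ?_
    push_cast; ring
  have h2 : HasDerivAt stdNormalPdf (-t * stdNormalPdf t) t := by
    refine (h1.exp.const_mul (√(2 * π))⁻¹).congr_deriv ?_
    rw [stdNormalPdf]; ring
  have h3 : HasDerivAt (fun t : ℝ => -(t / 2)) (-(1 / 2)) t := ((hasDerivAt_id t).div_const 2).neg
  exact (h3.mul h2).congr_deriv (by ring)

lemma tendsto_mul_stdNormalPdf_atTop :
    Filter.Tendsto (fun t => -(t / 2) * stdNormalPdf t) Filter.atTop (nhds 0) := by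
  have h := (rpow_mul_exp_neg_mul_sq_isLittleO_exp_neg (b := 1 / 2) (by norm_num) 1).trans_tendsto
    (tendsto_exp_atBot.comp (Filter.tendsto_id.const_mul_atTop_of_neg
      (show (-(1 / 2) : ℝ) < 0 by norm_num)))
  have h' := h.const_mul (-(√(2 * π))⁻¹ / 2)
  rw [mul_zero] at h'
  refine h'.congr fun t => ?_
  rw [rpow_one, stdNormalPdf, show -(1 / 2) * t ^ 2 = -t ^ 2 / 2 by ring]
  ring

lemma integral_stdNormalPdf_mul_excess : ∫ t, stdNormalPdf t * excess t = 0 := by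
  have hi := integrable_stdNormalPdf_sub_mul quadGrowth_excess 0
  simp only [sub_zero] at hi
  have hind : (fun t => stdNormalPdf t * excess t) =
      (Set.Ioi 0).indicator fun t => stdNormalPdf t * ((t ^ 2 - 1) / 2) := by
    ext t
    rcases lt_or_ge 0 t with ht | ht
    · rw [excess_of_pos ht, Set.indicator_of_mem (Set.mem_Ioi.2 ht)]
    · rw [excess_of_nonpos ht, Set.indicator_of_notMem (by simpa using ht), mul_zero]
  rw [hind, integrable_indicator_iff measurableSet_Ioi] at hi
  rw [hind, integral_indicator measurableSet_Ioi,
    integral_Ioi_of_hasDerivAt_of_tendsto' (fun t _ => hasDerivAt_mul_stdNormalPdf t) hi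
      tendsto_mul_stdNormalPdf_atTop]
  simp

lemma integral_stdNormalPdf_add_mul_excess_nonpos {d : ℝ} (hd : 0 ≤ d) :
    ∫ t, stdNormalPdf (t + d) * excess t ≤ 0 := by
  have hi := integrable_stdNormalPdf_sub_mul quadGrowth_excess 0
  have hid := integrable_stdNormalPdf_sub_mul quadGrowth_excess (-d)
  simp only [sub_zero, sub_neg_eq_add] at hi hid
  have hpt : ∀ t, stdNormalPdf (t + d) * excess t ≤
      exp (-d ^ 2 / 2 - d) * (stdNormalPdf t * excess t) := by
    intro t
    rcases lt_or_ge 0 t with ht | ht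
    · have hsplit : stdNormalPdf (t + d) = stdNormalPdf t * exp (-d ^ 2 / 2 - t * d) := by
        unfold stdNormalPdf
        rw [mul_assoc, ← exp_add]; congr 2; ring
      have hφ := stdNormalPdf_pos t
      rw [excess_of_pos ht, hsplit]
      suffices h : exp (-d ^ 2 / 2 - t * d) * ((t ^ 2 - 1) / 2) ≤
          exp (-d ^ 2 / 2 - d) * ((t ^ 2 - 1) / 2) by
        nlinarith [mul_le_mul_of_nonneg_left h hφ.le]
      rcases le_total 1 t with h1 | h1
      · exact mul_le_mul_of_nonneg_right (exp_le_exp.2 (by nlinarith)) (by nlinarith)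
      · exact mul_le_mul_of_nonpos_right (exp_le_exp.2 (by nlinarith)) (by nlinarith)
    · simp [excess_of_nonpos ht]
  have := integral_mono hid (hi.const_mul _) hpt
  rwa [integral_const_mul, integral_stdNormalPdf_mul_excess, mul_zero] at this

lemma quadGrowth_excess_sub (A : ℝ) : QuadGrowth fun y => excess (y - A) := by
  simpa [sub_eq_add_neg] using quadGrowth_excess.comp_affine 1 (-A)

lemma quadGrowth_excess_neg_sub (A : ℝ) : QuadGrowth fun y => excess (-y - A) := by
  simpa [sub_eq_add_neg] using quadGrowth_excess.comp_affine (-1) (-A)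

/-- The excess of `|y| - A`. -/
noncomputable def excessAbs (A y : ℝ) : ℝ := excess (y - A) + excess (-y - A)

lemma quadGrowth_excessAbs (A : ℝ) : QuadGrowth (excessAbs A) :=
  (quadGrowth_excess_sub A).add (quadGrowth_excess_neg_sub A)

lemma integral_stdNormalPdf_sub_mul_excessAbs_nonpos {A x : ℝ} (hx : x ∈ Set.Icc (-A) A) :
    ∫ y, stdNormalPdf (y - x) * excessAbs A y ≤ 0 := by
  have q1 := quadGrowth_excess_sub A
  have q2 := quadGrowth_excess_neg_sub A
  simp only [excessAbs, mul_add]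
  rw [integral_add (integrable_stdNormalPdf_sub_mul q1 x) (integrable_stdNormalPdf_sub_mul q2 x)]
  have e1 : ∫ y, stdNormalPdf (y - x) * excess (y - A) =
      ∫ t, stdNormalPdf (t + (A - x)) * excess t := by
    rw [← integral_sub_right_eq_self (fun t => stdNormalPdf (t + (A - x)) * excess t) A]
    congr 1 with y; congr 2; ring
  have e2 : ∫ y, stdNormalPdf (y - x) * excess (-y - A) =
      ∫ t, stdNormalPdf (t + (A + x)) * excess t := by
    rw [← integral_sub_right_eq_self (fun t => stdNormalPdf (t + (A + x)) * excess t) A,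
      ← integral_neg_eq_self]
    congr 1 with y
    rw [neg_neg, ← stdNormalPdf_neg]
    congr 2; ring
  rw [e1, e2]
  exact add_nonpos (integral_stdNormalPdf_add_mul_excess_nonpos (by linarith [hx.2]))
    (integral_stdNormalPdf_add_mul_excess_nonpos (by linarith [hx.1]))

lemma integrableOn_exp_neg_excess : IntegrableOn (fun t => exp (-excess t)) (Set.Ioi 0) := by
  have h : IntegrableOn (fun t : ℝ => exp (1 / 2) * exp (-(1 / 2) * t ^ 2)) (Set.Ioi 0) :=
    ((integrable_exp_neg_mul_sq (by norm_num)).const_mul _).integrableOn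
  refine h.congr_fun (fun t ht => ?_) measurableSet_Ioi
  simp only
  rw [excess_of_pos ht, ← exp_add]
  congr 1; ring

lemma setIntegral_exp_neg_excess :
    ∫ t in Set.Ioi 0, exp (-excess t) = √(2 * π * exp 1) / 2 := by
  have h : ∫ t in Set.Ioi 0, exp (-excess t) =
      ∫ t in Set.Ioi (0 : ℝ), exp (1 / 2) * exp (-(1 / 2) * t ^ 2) := by
    refine setIntegral_congr_fun measurableSet_Ioi fun t ht => ?_
    rw [excess_of_pos ht, ← exp_add]
    congr 1; ring
  rw [h, integral_const_mul, integral_gaussian_Ioi, sqrt_mul (by positivity), exp_half,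
    show π / (1 / 2) = 2 * π by ring]
  ring

lemma exp_neg_excessAbs_eq {A : ℝ} (hA : 0 < A) (y : ℝ) :
    exp (-excessAbs A y) = (Set.Icc (-A) A).indicator (fun _ => (1 : ℝ)) y +
      ((Set.Ioi 0).indicator (fun t => exp (-excess t)) (y - A) +
        (Set.Ioi 0).indicator (fun t => exp (-excess t)) (-y - A)) := by
  simp only [excessAbs, Set.indicator_apply, Set.mem_Icc, Set.mem_Ioi]
  rcases lt_or_ge A y with h1 | h1
  · rw [if_neg (by intro h; linarith [h.2]), if_pos (by linarith), if_neg (by linarith),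
      excess_of_nonpos (t := -y - A) (by linarith)]
    simp
  rcases lt_or_ge y (-A) with h2 | h2
  · rw [if_neg (by intro h; linarith [h.1]), if_neg (by linarith), if_pos (by linarith),
      excess_of_nonpos (t := y - A) (by linarith)]
    simp
  · rw [if_pos ⟨h2, h1⟩, if_neg (by linarith), if_neg (by linarith),
      excess_of_nonpos (t := y - A) (by linarith), excess_of_nonpos (t := -y - A) (by linarith)]
    simp

lemma integrable_exp_neg_excessAbs_and_integral_eq {A : ℝ} (hA : 0 < A) :
    Integrable (fun y => exp (-excessAbs A y)) ∧
      ∫ y, exp (-excessAbs A y) = √(2 * π * exp 1) + 2 * A := by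
  set G : ℝ → ℝ := (Set.Ioi 0).indicator fun t => exp (-excess t) with hG
  have iG : Integrable G := integrableOn_exp_neg_excess.integrable_indicator measurableSet_Ioi
  have vG : ∫ t, G t = √(2 * π * exp 1) / 2 := by
    rw [hG, integral_indicator measurableSet_Ioi, setIntegral_exp_neg_excess]
  have i1 : Integrable fun y => G (y - A) := iG.comp_sub_right A
  have i2 : Integrable fun y => G (-y - A) := i1.comp_neg
  have v1 : ∫ y, G (y - A) = √(2 * π * exp 1) / 2 := by rw [integral_sub_right_eq_self, vG]
  have v2 : ∫ y, G (-y - A) = √(2 * π * exp 1) / 2 := by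
    rw [integral_neg_eq_self (fun y => G (y - A)), v1]
  have i0 : Integrable ((Set.Icc (-A) A).indicator fun _ => (1 : ℝ)) :=
    (integrable_indicator_iff measurableSet_Icc).2 (integrableOn_const (by simp))
  have v0 : ∫ y, (Set.Icc (-A) A).indicator (fun _ => (1 : ℝ)) y = 2 * A := by
    rw [integral_indicator measurableSet_Icc]
    rw [setIntegral_const, measureReal_def, volume_Icc, ENNReal.toReal_ofReal (by linarith)]
    simp only [smul_eq_mul]; ring
  have i12 : Integrable fun y => G (y - A) + G (-y - A) := i1.add i2
  simp only [exp_neg_excessAbs_eq hA]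
  refine ⟨i0.add i12, ?_⟩
  rw [integral_add i0 i12, integral_add i1 i2, v0, v1, v2]
  ring

/-- McKellips' bound: the output entropy under the amplitude constraint `A` is at most
`log (√(2πe) + 2A)`. -/
lemma neg_log_le_integral_outDen_mul_log {A : ℝ} (hA : 0 < A) {Q : Measure ℝ}
    [IsProbabilityMeasure Q] (hQ : ∀ᵐ x ∂Q, x ∈ Set.Icc (-A) A) :
    -log (√(2 * π * exp 1) + 2 * A) ≤ ∫ y, outDen Q y * log (outDen Q y) := by
  obtain ⟨iE, vE⟩ := integrable_exp_neg_excessAbs_and_integral_eq hA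
  set S := √(2 * π * exp 1) + 2 * A
  have hS : 0 < S := by positivity
  have iQ := integrable_outDen hQ
  have ie := integrable_outDen_mul hQ (quadGrowth_excessAbs A)
  have hpt : ∀ y, outDen Q y * (1 - log S) - outDen Q y * excessAbs A y -
      exp (-excessAbs A y) / S ≤ outDen Q y * log (outDen Q y) := by
    intro y
    have hq := outDen_pos hQ y
    have hl := log_le_sub_one_of_pos (div_pos (div_pos (exp_pos (-excessAbs A y)) hS) hq)
    rw [log_div (by positivity) hq.ne', log_div (exp_pos _).ne' hS.ne', log_exp] at hl
    have := mul_le_mul_of_nonneg_left hl hq.le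
    rw [mul_sub _ _ (1 : ℝ), mul_div_cancel₀ _ hq.ne'] at this
    linarith
  have i₁ : Integrable fun y => outDen Q y * (1 - log S) := iQ.mul_const _
  have i₁₂ : Integrable fun y => outDen Q y * (1 - log S) - outDen Q y * excessAbs A y := i₁.sub ie
  have hmono := integral_mono (i₁₂.sub (iE.div_const S))
    (integrable_outDen_mul hQ (quadGrowth_log_outDen hQ)) hpt
  simp only [Pi.sub_apply] at hmono
  rw [integral_sub i₁₂ (iE.div_const S), integral_sub i₁ ie,
    integral_mul_const, integral_div, vE, integral_outDen hQ, div_self hS.ne'] at hmono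
  have := integral_outDen_mul_nonpos hQ (quadGrowth_excessAbs A)
    fun x hx => integral_stdNormalPdf_sub_mul_excessAbs_nonpos hx
  linarith

/-! ### The uniform input -/

/-- The uniform distribution on `[-A, A]`. -/
noncomputable def uniformIcc (A : ℝ) : Measure ℝ :=
  ENNReal.ofReal (1 / (2 * A)) • volume.restrict (Set.Icc (-A) A)

section Uniform

variable {A : ℝ}

lemma isProbabilityMeasure_uniformIcc (hA : 0 < A) : IsProbabilityMeasure (uniformIcc A) := by
  refine ⟨?_⟩
  rw [uniformIcc, Measure.smul_apply, Measure.restrict_apply_univ, volume_Icc, smul_eq_mul,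
    ← ENNReal.ofReal_mul (by positivity), sub_neg_eq_add, ← two_mul,
    one_div_mul_cancel (by positivity), ENNReal.ofReal_one]

lemma ae_mem_uniformIcc : ∀ᵐ x ∂uniformIcc A, x ∈ Set.Icc (-A) A :=
  Measure.ae_smul_measure (ae_restrict_mem measurableSet_Icc) _

lemma outDen_uniformIcc (hA : 0 < A) (y : ℝ) :
    outDen (uniformIcc A) y = ∫ u in Set.Icc (-A) A, (1 / (2 * A)) * stdNormalPdf (y - u) := by
  rw [outDen, uniformIcc, integral_smul_measure, ENNReal.toReal_ofReal (by positivity),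
    smul_eq_mul, integral_const_mul]

lemma outDen_uniformIcc_le (hA : 0 < A) (y : ℝ) : outDen (uniformIcc A) y ≤ 1 / (2 * A) := by
  rw [outDen_uniformIcc hA, integral_const_mul]
  refine mul_le_of_le_one_right (by positivity) ?_
  refine (setIntegral_le_integral (integrable_stdNormalPdf.comp_sub_left y)
    (.of_forall fun u => (stdNormalPdf_pos _).le)).trans_eq ?_
  rw [integral_sub_left_eq_self stdNormalPdf, integral_stdNormalPdf]

lemma integral_outDen_uniformIcc_mul_log_le (hA : 0 < A) :
    ∫ y, outDen (uniformIcc A) y * log (outDen (uniformIcc A) y) ≤ -log (2 * A) := by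
  have := isProbabilityMeasure_uniformIcc hA
  have hU := ae_mem_uniformIcc (A := A)
  have := integral_mono (integrable_outDen_mul hU (quadGrowth_log_outDen hU))
    ((integrable_outDen hU).mul_const (-log (2 * A))) fun y => by
      have hp := outDen_pos hU y
      have hl := log_le_log hp (outDen_uniformIcc_le hA y)
      rw [one_div, log_inv] at hl
      exact mul_le_mul_of_nonneg_left hl hp.le
  rwa [integral_mul_const, integral_outDen hU, one_mul] at this

end Uniform

theorem stmt_14 (A : ℝ) (hA : 0 < A)
    (Pstar : Measure ℝ) [IsProbabilityMeasure Pstar]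
    (hsupp : ∀ᵐ x ∂Pstar, x ∈ Set.Icc (-A) A)
    (hopt : ∀ Q : Measure ℝ, IsProbabilityMeasure Q → (∀ᵐ x ∂Q, x ∈ Set.Icc (-A) A) →
      awgnMI Q ≤ awgnMI Pstar)
    (fU : ℝ → ℝ)
    (hfU : ∀ y, fU y = ∫ u in Set.Icc (-A) A, (1 / (2 * A)) * stdNormalPdf (y - u)) :
    ∫ y : ℝ, fU y * Real.log (fU y / outDen Pstar y) ≤
      Real.sqrt (π * Real.exp 1 / 2) / A := by
  have := isProbabilityMeasure_uniformIcc hA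
  have hU := ae_mem_uniformIcc (A := A)
  obtain rfl : fU = outDen (uniformIcc A) :=
    funext fun y => (hfU y).trans (outDen_uniformIcc hA y).symm
  have hsplit : ∫ y, outDen (uniformIcc A) y *
      log (outDen (uniformIcc A) y / outDen Pstar y) =
      (∫ y, outDen (uniformIcc A) y * log (outDen (uniformIcc A) y)) -
        ∫ y, outDen (uniformIcc A) y * log (outDen Pstar y) := by
    rw [← integral_sub (integrable_outDen_mul hU (quadGrowth_log_outDen hU))
      (integrable_outDen_mul hU (quadGrowth_log_outDen hsupp))]
    refine integral_congr_ae (.of_forall fun y => ?_)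
    simp only
    rw [log_div (outDen_pos hU y).ne' (outDen_pos hsupp y).ne', mul_sub]
  have hsaddle := integral_outDen_mul_log_le_of_forall_awgnMI_le hsupp hopt hU
  have hent := neg_log_le_integral_outDen_mul_log hA hsupp
  have huni := integral_outDen_uniformIcc_mul_log_le hA
  have hlog := log_le_sub_one_of_pos
    (show 0 < (√(2 * π * exp 1) + 2 * A) / (2 * A) by positivity)
  rw [log_div (by positivity) (by positivity), add_div, div_self (by positivity),
    add_sub_cancel_right] at hlog
  have hsqrt : √(2 * π * exp 1) = 2 * √(π * exp 1 / 2) := by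
    rw [show 2 * π * exp 1 = 2 ^ 2 * (π * exp 1 / 2) by ring, sqrt_mul (by positivity),
      sqrt_sq (by norm_num)]
  have hval : √(2 * π * exp 1) / (2 * A) = √(π * exp 1 / 2) / A := by
    rw [hsqrt, mul_div_mul_left _ _ two_ne_zero]
  rw [hsplit, ← hval]
  linarith
end

section
/- Let X ∈ [-A, A] (A > 1) be a discrete random variable with K > 1 mass points, Z ~ N(0,1) independent of X, U ~ Uniform[-A,A]. If the wrapped density f_{⟨X+Z⟩_A} is bounded by M, then TV(P_{⟨X+Z⟩_A}, P_{⟨U+Z⟩_A}) ≥ (1/(2(2πM+1))) exp(-4π² K²/A²). -/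
open Real MeasureTheory Finset

theorem hasSum_integral_mul_of_summable_norm (c : ℤ → ℂ) (hc : Summable fun n => ‖c n‖)
    (h g : ℝ → ℂ) (hh : Continuous h)
    (hg : ∀ θ : ℝ, HasSum (fun n : ℤ => c n * Complex.exp (-(Complex.I * n * θ))) (g θ)) :
    HasSum (fun n : ℤ => c n * ∫ θ in (-π)..π, Complex.exp (-(Complex.I * n * θ)) * h θ)
      (∫ θ in (-π)..π, g θ * h θ) := by
  simp_rw [← intervalIntegral.integral_const_mul]
  refine intervalIntegral.hasSum_integral_of_dominated_convergence
    (fun n θ => ‖c n‖ * ‖h θ‖) (fun n => ?_) (fun n => ?_) ?_ ?_ ?_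
  · exact Continuous.aestronglyMeasurable (by fun_prop)
  · refine Filter.Eventually.of_forall fun θ _ => ?_
    simp [Complex.norm_exp]
  · exact Filter.Eventually.of_forall fun θ _ => hc.mul_right _
  · simp_rw [tsum_mul_right]
    exact Continuous.intervalIntegrable (by fun_prop) _ _
  · refine Filter.Eventually.of_forall fun θ _ => ?_
    simpa only [mul_assoc] using (hg θ).mul_right (h θ)

theorem integral_exp_neg_I_int (n : ℤ) :
    ∫ θ in (-π)..π, Complex.exp (-(Complex.I * n * θ)) = if n = 0 then 2 * (π : ℂ) else 0 := by
  split_ifs with hn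
  · simp [hn]; ring
  · have hne : -(Complex.I * n) ≠ 0 := by simp [hn]
    have key := integral_exp_mul_complex (a := -π) (b := π) hne
    simp_rw [neg_mul] at key
    rw [key, div_eq_zero_iff]
    left
    rw [sub_eq_zero, Complex.exp_eq_exp_iff_exists_int]
    exact ⟨-n, by push_cast; ring⟩

theorem hasSum_sq_norm_integral_sq (c : ℤ → ℂ) (hc : Summable fun n => ‖c n‖)
    (hconj : ∀ n, c (-n) = starRingEnd ℂ (c n)) (g : ℝ → ℝ) (hgc : Continuous g)
    (hg : ∀ θ : ℝ, HasSum (fun n : ℤ => c n * Complex.exp (-(Complex.I * n * θ))) (g θ : ℂ)) :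
    HasSum (fun n : ℤ => 2 * π * ‖c n‖ ^ 2) (∫ θ in (-π)..π, g θ ^ 2) := by
  have hcoeff : ∀ n : ℤ, ∫ θ in (-π)..π, Complex.exp (-(Complex.I * n * θ)) * (g θ : ℂ)
      = 2 * π * c (-n) := by
    intro n
    have h1 := hasSum_integral_mul_of_summable_norm c hc
      (fun θ => Complex.exp (-(Complex.I * n * θ))) (fun θ => g θ) (by fun_prop) hg
    have h2 : ∀ k : ℤ, ∫ θ in (-π)..π, Complex.exp (-(Complex.I * k * θ)) *
        Complex.exp (-(Complex.I * n * θ)) = if k = -n then 2 * (π : ℂ) else 0 := by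
      intro k
      have := integral_exp_neg_I_int (k + n)
      simp_rw [← Complex.exp_add]
      simp only [add_eq_zero_iff_eq_neg] at this
      rw [← this]
      congr 1
      ext θ
      push_cast
      ring_nf
    simp_rw [h2] at h1
    have h3 := hasSum_ite_eq (-n) (c (-n) * (2 * (π : ℂ)))
    have h4 := h1.unique (by
      convert h3 using 2 with k
      split_ifs with h
      · rw [h]
      · simp)
    rw [mul_comm (2 * (π : ℂ)), ← h4]
    exact intervalIntegral.integral_congr fun θ _ => mul_comm _ _
  have h1 := hasSum_integral_mul_of_summable_norm c hc
      (fun θ => g θ) (fun θ => g θ) (by fun_prop) hg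
  simp_rw [hcoeff, hconj] at h1
  rw [← Complex.hasSum_ofReal, ← intervalIntegral.integral_ofReal]
  convert h1 using 2 with n
  · push_cast
    rw [← Complex.mul_conj']
    ring
  · simp only [sq, Complex.ofReal_mul]

theorem hasSum_stdNormalPdf (A : ℝ) (hA : 0 < A) (x θ : ℝ) :
    Summable (fun j : ℤ => stdNormalPdf ((A / π) * (θ + 2 * π * j) - x)) ∧
    HasSum (fun n : ℤ => ((2 * π)⁻¹ * Real.exp (-π ^ 2 * n ^ 2 / (2 * A ^ 2)) : ℝ) *
      Complex.exp (Complex.I * n * (π * x / A : ℝ)) * Complex.exp (-(Complex.I * n * θ)))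
      ((A / π * ∑' j : ℤ, stdNormalPdf ((A / π) * (θ + 2 * π * j) - x) : ℝ) : ℂ) := by
  have hπ := Real.pi_pos
  set t : ℝ := (θ - π * x / A) / (2 * π) with ht
  set a : ℝ := π / (2 * A ^ 2) with ha
  have ha0 : 0 < a := by positivity
  have harg : ∀ j : ℤ, (A / π) * (θ + 2 * π * j) - x = 2 * A * (j + t) := by
    intro j; rw [ht]; field_simp; ring
  have hpdf : ∀ j : ℤ, (stdNormalPdf ((A / π) * (θ + 2 * π * j) - x) : ℂ) =
      ((Real.sqrt (2 * π))⁻¹ : ℝ) *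
        Complex.exp (-π / a * (j + Complex.I * (-Complex.I * t)) ^ 2) := by
    intro j
    rw [harg, stdNormalPdf, ← mul_assoc, mul_neg, Complex.I_mul_I, neg_neg, one_mul]
    push_cast
    congr 2
    rw [ha]
    push_cast
    field_simp
  have hsum1 : Summable fun j : ℤ =>
      Complex.exp (-π / a * (j + Complex.I * (-Complex.I * t)) ^ 2) := by
    have h := (summable_jacobiTheta₂_term_iff (Complex.I * t / a) (Complex.I / a)).2
      (by simpa using ha0)
    refine (h.mul_left (Complex.exp (-π / a * t ^ 2))).congr fun j => ?_
    rw [jacobiTheta₂_term, ← Complex.exp_add]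
    congr 1
    have : (a : ℂ) ≠ 0 := by exact_mod_cast ha0.ne'
    field_simp
    linear_combination ((j : ℂ) ^ 2 + (Complex.I ^ 2 - 1) * t ^ 2) * Complex.I_sq
  have hsum2 : Summable fun n : ℤ =>
      Complex.exp (-π * a * n ^ 2 + 2 * π * (-Complex.I * t) * n) := by
    have h := (summable_jacobiTheta₂_term_iff (-t) (Complex.I * a)).2 (by simpa using ha0)
    refine h.congr fun j => ?_
    rw [jacobiTheta₂_term]
    congr 1
    linear_combination ((j : ℂ) ^ 2 * π * a) * Complex.I_sq
  have hq := Complex.tsum_exp_neg_quadratic (a := a) (by simpa using ha0) (-Complex.I * t)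
  have hsqrt : ((a : ℂ) ^ (1 / 2 : ℂ)) = (Real.sqrt a : ℝ) := by
    rw [Real.sqrt_eq_rpow, Complex.ofReal_cpow ha0.le]
    norm_num
  have hconst : A / π * (Real.sqrt (2 * π))⁻¹ = (2 * π)⁻¹ * (1 / Real.sqrt a) := by
    have h1 : Real.sqrt a = Real.sqrt (2 * π) / (2 * A) := by
      rw [Real.sqrt_eq_iff_mul_self_eq ha0.le (by positivity), div_mul_div_comm,
        Real.mul_self_sqrt (by positivity), ha]
      field_simp
    rw [h1]
    have : 0 < Real.sqrt (2 * π) := by positivity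
    field_simp
  refine ⟨?_, ?_⟩
  · rw [← Complex.summable_ofReal]
    simp_rw [hpdf]
    exact hsum1.mul_left _
  · have hs := hsum2.hasSum.mul_left ((2 * π)⁻¹ : ℂ)
    have hval : ((A / π * ∑' j : ℤ, stdNormalPdf ((A / π) * (θ + 2 * π * j) - x) : ℝ) : ℂ) =
        (2 * (π : ℂ))⁻¹ *
          ∑' n : ℤ, Complex.exp (-π * a * n ^ 2 + 2 * π * (-Complex.I * t) * n) := by
      rw [hq, hsqrt, Complex.ofReal_mul, Complex.ofReal_tsum]
      simp_rw [hpdf]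
      rw [tsum_mul_left, ← mul_assoc, ← mul_assoc ((2 * (π : ℂ))⁻¹)]
      congr 1
      exact_mod_cast hconst
    rw [hval]
    refine hs.congr_fun fun n => ?_
    push_cast
    rw [mul_assoc, mul_assoc, ← Complex.exp_add, ← Complex.exp_add]
    congr 2
    rw [ht, ha]
    push_cast
    have : (A : ℂ) ≠ 0 := by exact_mod_cast hA.ne'
    have : (π : ℂ) ≠ 0 := by exact_mod_cast hπ.ne'
    field_simp
    ring

theorem le_sum_sq_norm_trigMoment {K : ℕ} (hK : 0 < K) (N : ℕ) (p α : Fin K → ℝ)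
    (hp : ∀ m, 0 ≤ p m) (hsum : ∑ m, p m = 1) :
    (N : ℝ) / K ≤ ∑ n ∈ Finset.Ioo (-(N : ℤ)) N,
      ‖∑ m, (p m : ℂ) * Complex.exp (Complex.I * n * α m)‖ ^ 2 := by
  set a : ℤ → ℂ := fun n => ∑ m, (p m : ℂ) * Complex.exp (Complex.I * n * α m) with ha
  have hrow : ∀ i ∈ Finset.range N, ∑ l ∈ Finset.range N, ‖a (i - l)‖ ^ 2 ≤
      ∑ n ∈ Finset.Ioo (-(N : ℤ)) N, ‖a n‖ ^ 2 := by
    intro i hi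
    rw [← Finset.sum_image (f := fun n => ‖a n‖ ^ 2) (s := Finset.range N)
      (g := fun l : ℕ => (i : ℤ) - l) (by intro u _ v _ h; simpa using h)]
    refine Finset.sum_le_sum_of_subset_of_nonneg ?_ (fun _ _ _ => by positivity)
    intro n hn
    simp only [Finset.mem_image, Finset.mem_range, Finset.mem_Ioo] at *
    omega
  have hfejer : ∑ i ∈ Finset.range N, ∑ l ∈ Finset.range N, ‖a (i - l)‖ ^ 2 =
      ∑ j, ∑ k, p j * p k *
        ‖∑ i ∈ Finset.range N, Complex.exp (Complex.I * i * (α j - α k))‖ ^ 2 := by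
    rw [← Complex.ofReal_inj]
    push_cast
    simp_rw [← Complex.mul_conj', ha, map_sum, Finset.sum_mul_sum, Finset.mul_sum]
    rw [Finset.sum_congr rfl fun i _ => Finset.sum_comm, Finset.sum_comm]
    refine Finset.sum_congr rfl fun j _ => ?_
    rw [Finset.sum_congr rfl fun i _ => Finset.sum_comm, Finset.sum_comm]
    refine Finset.sum_congr rfl fun k _ => ?_
    refine Finset.sum_congr rfl fun i _ => Finset.sum_congr rfl fun l _ => ?_
    simp only [map_mul, Complex.conj_ofReal, ← Complex.exp_conj, map_sub, Complex.conj_I,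
      map_intCast, map_natCast]
    rw [mul_mul_mul_comm, ← Complex.exp_add, ← Complex.exp_add]
    congr 2
    push_cast
    ring
  have hdiag : (N : ℝ) ^ 2 * ∑ j, p j ^ 2 ≤ ∑ j, ∑ k, p j * p k *
        ‖∑ i ∈ Finset.range N, Complex.exp (Complex.I * i * (α j - α k))‖ ^ 2 := by
    rw [Finset.mul_sum]
    refine Finset.sum_le_sum fun j _ => ?_
    refine le_trans (le_of_eq ?_) (Finset.single_le_sum (fun k _ =>
      mul_nonneg (mul_nonneg (hp j) (hp k)) (by positivity)) (Finset.mem_univ j))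
    simp
    ring
  have hcs : 1 ≤ (K : ℝ) * ∑ j, p j ^ 2 := by
    have := sq_sum_le_card_mul_sum_sq (s := Finset.univ) (f := p)
    rw [hsum] at this
    simpa using this
  have htot := Finset.sum_le_sum hrow
  rw [hfejer, Finset.sum_const, Finset.card_range, nsmul_eq_mul] at htot
  have hKr : (0 : ℝ) < K := by exact_mod_cast hK
  rcases N.eq_zero_or_pos with rfl | hN
  · simp
  have hNr : (0 : ℝ) < N := by exact_mod_cast hN
  have h1 : (N : ℝ) * (N * ∑ j, p j ^ 2) ≤
      N * ∑ n ∈ Finset.Ioo (-(N : ℤ)) N, ‖a n‖ ^ 2 := by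
    linarith [hdiag.trans htot]
  have h2 := le_of_mul_le_mul_left h1 hNr
  refine le_trans ?_ h2
  rw [div_le_iff₀ hKr]
  nlinarith

theorem stmt_19 (A : ℝ) (hA : 1 < A) (K : ℕ) (hK : 1 < K) (M : ℝ)
    (x : Fin K → ℝ) (hx : ∀ m, x m ∈ Set.Icc (-A) A) (hinj : Function.Injective x)
    (p : Fin K → ℝ) (hp : ∀ m, 0 < p m) (hsum : ∑ m, p m = 1)
    (f : ℝ → ℝ)
    (hf : ∀ θ, f θ =
      (A / π) * ∑' j : ℤ, ∑ m, p m * stdNormalPdf ((A / π) * (θ + 2 * π * j) - x m))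
    (hbdd : ∀ θ, f θ ≤ M) :
    (1 / (2 * (2 * π * M + 1))) * Real.exp (-4 * π ^ 2 * (K : ℝ) ^ 2 / A ^ 2) ≤
      (1 / 2) * ∫ θ in Set.Ioo (-π) π, |f θ - 1 / (2 * π)| := by
  have hπ := Real.pi_pos
  have hA0 : 0 < A := by linarith
  have hf0 : ∀ θ, 0 ≤ f θ := fun θ => by
    rw [hf]
    refine mul_nonneg (by positivity) (tsum_nonneg fun j => Finset.sum_nonneg fun m _ =>
      mul_nonneg (hp m).le ?_)
    unfold stdNormalPdf
    positivity
  have hM : 0 ≤ M := (hf0 0).trans (hbdd 0)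
  set a : ℤ → ℂ := fun n => ∑ m, (p m : ℂ) * Complex.exp (Complex.I * n * (π * x m / A : ℝ))
    with ha
  set w : ℤ → ℝ := fun n => (2 * π)⁻¹ * Real.exp (-π ^ 2 * n ^ 2 / (2 * A ^ 2)) with hw
  have hfser : ∀ θ : ℝ, HasSum (fun n : ℤ => (w n * a n) * Complex.exp (-(Complex.I * n * θ)))
      (f θ : ℂ) := by
    intro θ
    have h := hasSum_sum (s := Finset.univ) fun m _ =>
      (hasSum_stdNormalPdf A hA0 (x m) θ).2.mul_left (p m : ℂ)
    have hval : (f θ : ℂ) = ∑ m, (p m : ℂ) *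
        (A / π * ∑' j : ℤ, stdNormalPdf ((A / π) * (θ + 2 * π * j) - x m) : ℝ) := by
      rw [hf, Summable.tsum_finsetSum fun m _ =>
        (hasSum_stdNormalPdf A hA0 (x m) θ).1.mul_left (p m)]
      simp_rw [tsum_mul_left]
      rw [Finset.mul_sum]
      push_cast
      refine Finset.sum_congr rfl fun m _ => ?_
      ring
    rw [hval]
    refine h.congr_fun fun n => ?_
    rw [ha, Finset.mul_sum, Finset.sum_mul]
    refine Finset.sum_congr rfl fun m _ => ?_
    ring
  have hsummable : Summable fun n => ‖(w n : ℂ) * a n‖ := by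
    have h := (hfser 0).summable.norm
    simpa using h
  have ha0 : a 0 = 1 := by
    simp only [ha, Int.cast_zero, mul_zero, zero_mul, Complex.exp_zero, mul_one]
    exact_mod_cast hsum
  set c : ℤ → ℂ := Function.update (fun n => (w n : ℂ) * a n) 0 0 with hc
  have hcne : ∀ n, n ≠ 0 → c n = w n * a n := fun n hn => by simp [hc, hn]
  have hc0 : c 0 = 0 := by simp [hc]
  have hcsum : Summable fun n => ‖c n‖ := by
    refine Summable.of_nonneg_of_le (fun _ => norm_nonneg _) (fun n => ?_) hsummable
    by_cases hn : n = 0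
    · rw [hn, hc0, norm_zero]; exact norm_nonneg _
    · rw [hcne n hn]
  have hconj : ∀ n, c (-n) = starRingEnd ℂ (c n) := by
    intro n
    by_cases hn : n = 0
    · rw [hn]; simp [hc0]
    · rw [hcne n hn, hcne (-n) (by simpa using hn)]
      simp [ha, hw, ← Complex.exp_conj, map_ofNat]
  set g : ℝ → ℝ := fun θ => f θ - 1 / (2 * π) with hg
  have hgser : ∀ θ : ℝ, HasSum (fun n : ℤ => c n * Complex.exp (-(Complex.I * n * θ)))
      (g θ : ℂ) := by
    intro θ
    have h := (hfser θ).update 0 0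
    have hval : (g θ : ℂ) = 0 - w 0 * a 0 * Complex.exp (-(Complex.I * (0 : ℤ) * θ)) + f θ := by
      simp [hg, ha0, hw]
      ring
    rw [hval]
    refine h.congr_fun fun n => ?_
    by_cases hn : n = 0
    · simp [hn, hc0]
    · simp [hn, hcne n hn]
  have hgc : Continuous g := by
    have h : Continuous fun θ : ℝ => ∑' n : ℤ, c n * Complex.exp (-(Complex.I * n * θ)) := by
      refine continuous_tsum (fun n => by fun_prop) hcsum fun n θ => ?_
      simp [Complex.norm_exp]
    simp_rw [fun θ => (hgser θ).tsum_eq] at h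
    exact Complex.continuous_re.comp h
  have hpars := hasSum_sq_norm_integral_sq c hcsum hconj g hgc hgser
  set E := Real.exp (-4 * π ^ 2 * (K : ℝ) ^ 2 / A ^ 2) with hE
  have hmom := le_sum_sq_norm_trigMoment (by omega : 0 < K) (2 * K) p (fun m => π * x m / A)
    (fun m => (hp m).le) hsum
  have hlow : (2 * π)⁻¹ * E ≤ ∫ θ in (-π)..π, g θ ^ 2 := by
    refine le_trans ?_ (sum_le_hasSum ((Finset.Ioo (-((2 * K : ℕ) : ℤ)) (2 * K : ℕ)).erase 0)
      (fun n _ => by positivity) hpars)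
    have h0 : (0 : ℤ) ∈ Finset.Ioo (-((2 * K : ℕ) : ℤ)) (2 * K : ℕ) := by
      simp only [Finset.mem_Ioo]; omega
    rw [← Finset.add_sum_erase _ _ h0] at hmom
    have h1 : 1 ≤ ∑ n ∈ (Finset.Ioo (-((2 * K : ℕ) : ℤ)) (2 * K : ℕ)).erase 0, ‖a n‖ ^ 2 := by
      have hK0 : (K : ℝ) ≠ 0 := by positivity
      have h2 : ((2 * K : ℕ) : ℝ) / K = 2 := by push_cast; field_simp
      have h3 : ‖a 0‖ ^ 2 = 1 := by rw [ha0]; simp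
      change ((2 * K : ℕ) : ℝ) / K ≤ ‖a 0‖ ^ 2 + ∑ n ∈ _, ‖a n‖ ^ 2 at hmom
      linarith
    calc (2 * π)⁻¹ * E ≤ (2 * π)⁻¹ * E *
          ∑ n ∈ (Finset.Ioo (-((2 * K : ℕ) : ℤ)) (2 * K : ℕ)).erase 0, ‖a n‖ ^ 2 :=
          le_mul_of_one_le_right (by positivity) h1
      _ ≤ _ := by
        rw [Finset.mul_sum]
        refine Finset.sum_le_sum fun n hn => ?_
        rw [Finset.mem_erase, Finset.mem_Ioo] at hn
        rw [hcne n hn.1, norm_mul, mul_pow, ← mul_assoc]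
        refine mul_le_mul_of_nonneg_right ?_ (by positivity)
        rw [Complex.norm_real, Real.norm_eq_abs, sq_abs, hw]
        dsimp only
        rw [mul_pow, ← Real.exp_nat_mul]
        have hn2 : (n : ℝ) ^ 2 ≤ 4 * K ^ 2 := by
          have : n ^ 2 ≤ (2 * K) ^ 2 := by
            apply sq_le_sq'
            · have := hn.2.1; push_cast at this; omega
            · have := hn.2.2; push_cast at this; omega
          have : (n : ℝ) ^ 2 ≤ (2 * K) ^ 2 := by exact_mod_cast this
          linarith
        have hexp : E ≤ Real.exp ((2 : ℕ) * (-π ^ 2 * n ^ 2 / (2 * A ^ 2))) := by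
          rw [hE, Real.exp_le_exp]
          have : ((2 : ℕ) : ℝ) * (-π ^ 2 * n ^ 2 / (2 * A ^ 2)) = -π ^ 2 * n ^ 2 / A ^ 2 := by
            push_cast; field_simp
          rw [this]
          gcongr ?_ / _
          nlinarith [mul_le_mul_of_nonneg_left hn2 (sq_nonneg π)]
        have : (2 * π)⁻¹ = 2 * π * ((2 * π)⁻¹) ^ 2 := by field_simp
        rw [← mul_assoc, ← this]
        gcongr
  have hupp : ∫ θ in (-π)..π, g θ ^ 2 ≤ (M + (2 * π)⁻¹) * ∫ θ in (-π)..π, |g θ| := by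
    rw [← intervalIntegral.integral_const_mul]
    refine intervalIntegral.integral_mono_on (by linarith)
      ((hgc.pow 2).intervalIntegrable _ _)
      ((continuous_const.mul hgc.abs).intervalIntegrable _ _) fun θ _ => ?_
    rw [← sq_abs, sq]
    refine mul_le_mul_of_nonneg_right ?_ (abs_nonneg _)
    have : 0 < (2 * π)⁻¹ := by positivity
    rw [hg, abs_le, one_div]
    constructor <;> linarith [hf0 θ, hbdd θ]
  rw [← integral_Ioc_eq_integral_Ioo, ← intervalIntegral.integral_of_le (by linarith)]
  have hfin := hlow.trans hupp
  change _ ≤ 1 / 2 * ∫ θ in (-π)..π, |g θ|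
  set J := ∫ θ in (-π)..π, |g θ|
  have hscaled : E ≤ (2 * π * M + 1) * J := by
    have := mul_le_mul_of_nonneg_left hfin (by positivity : 0 ≤ 2 * π)
    calc E = 2 * π * ((2 * π)⁻¹ * E) := by field_simp
      _ ≤ _ := this
      _ = _ := by field_simp
  rw [one_div_mul_eq_div, div_le_iff₀ (by positivity)]
  linarith
end
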